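/- arXiv:2601.18039 — 2 statements merged into one kernel-verified Lean document; each statement's English description precedes it below -/
import Mathlib

section
/- Let K be a field of characteristic zero, r ≥ 1, and let u₁, …, u_{r+1} ∈ K[x] be a normalized collection with parameters c₁, …, c_{r+1} ∈ K \ {0}: for each i, the coefficient of x^j in u_i is 0 for j < i − 1 and the coefficient of x^{i−1} equals c_i/(i−1)!. Set f_j = Wr(u₁, …, u_j) for 1 ≤ j ≤ r+1 and f₀ = 1. Fix 1 ≤ i ≤ r and a ∈ K \ {0}, and define g := Wr(u₁, …, u_{i−1}, a⁻¹u_i + u_{i+1}) − a⁻¹·f_i. Then: (1) f_i·g′ − f_i′·g = f_{i−1}·f_{i+1}; (2) the constant coefficient of g is 0; (3) the coefficient of x in g equals c₁·⋯·c_{i−1}·c_{i+1}. (In other words, the Wronskian map intertwines the evolution A_i(a) on normalized collections with the corresponding evolution on tuples of Wronskians, Theorem 3.5.) -/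
open Polynomial

/-- The Wronskian of a family of `k` polynomials (0-based indexing of derivatives). -/
noncomputable def wronskian' {R : Type*} [CommRing R] {k : ℕ} (u : Fin k → R[X]) : R[X] :=
  (Matrix.of fun i j : Fin k => (derivative^[(i : ℕ)] (u j))).det

section DerivativeMatrix

variable {R : Type*} [CommRing R]

/-- The square matrix whose `(i, j)` entry is the `e i`-th derivative of `u j`. -/
noncomputable def derivativeMatrix {n : ℕ} (e : Fin n → ℕ) (u : Fin n → R[X]) :
    Matrix (Fin n) (Fin n) R[X] :=
  Matrix.of fun i j => derivative^[e i] (u j)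

theorem wronskian'_eq_det {n : ℕ} (u : Fin n → R[X]) :
    wronskian' u = (derivativeMatrix (fun i => (i : ℕ)) u).det :=
  rfl

theorem derivative_det {n : Type*} [Fintype n] [DecidableEq n] (M : Matrix n n R[X]) :
    derivative M.det = ∑ i, (M.updateRow i fun j => derivative (M i j)).det := by
  rw [← Matrix.det_transpose, Matrix.det_apply', derivative_sum]
  have key : ∀ i, (M.updateRow i fun j => derivative (M i j)).det =
      ∑ σ : Equiv.Perm n, ((Equiv.Perm.sign σ : ℤ) : R[X]) *
        ((∏ b ∈ Finset.univ.erase i, M b (σ b)) * derivative (M i (σ i))) := by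
    intro i
    rw [← Matrix.det_transpose, Matrix.det_apply']
    refine Finset.sum_congr rfl fun σ _ => ?_
    rw [← Finset.prod_erase_mul _ _ (Finset.mem_univ i)]
    congr 2
    · refine Finset.prod_congr rfl fun b hb => ?_
      simp [Matrix.updateRow_ne (Finset.ne_of_mem_erase hb)]
    · simp
  simp_rw [key]
  rw [Finset.sum_comm]
  refine Finset.sum_congr rfl fun σ _ => ?_
  rw [← Finset.mul_sum, derivative_intCast_mul, derivative_prod_finset]
  rfl

/-- Only the last row contributes to the derivative of a Wronskian. -/
theorem derivative_wronskian'_succ {k : ℕ} (u : Fin (k + 1) → R[X]) :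
    derivative (wronskian' u) =
      (derivativeMatrix (Fin.append (fun i : Fin k => (i : ℕ)) ![k + 1]) u).det := by
  rw [wronskian'_eq_det, derivative_det, Finset.sum_eq_single (Fin.last k)]
  · congr 1
    ext i j : 2
    refine Fin.addCases (fun i => ?_) (fun i => ?_) i
    · have h : Fin.castAdd 1 i ≠ Fin.last k := (Fin.castSucc_lt_last i).ne
      rw [Matrix.updateRow_ne h]
      simp [derivativeMatrix]
    · obtain rfl : i = 0 := Subsingleton.elim _ _
      have h : Fin.natAdd k (0 : Fin 1) = Fin.last k := rfl
      rw [h, Matrix.updateRow_self, ← h]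
      simp only [derivativeMatrix, Matrix.of_apply, Fin.append_right]
      simp [Function.iterate_succ_apply']
  · intro i _ hi
    obtain ⟨i, rfl⟩ := Fin.exists_castSucc_eq.2 hi
    refine Matrix.det_zero_of_row_eq (i := i.castSucc) (j := i.succ) Fin.castSucc_lt_succ.ne ?_
    rw [Matrix.updateRow_self, Matrix.updateRow_ne Fin.castSucc_lt_succ.ne']
    ext1 j
    simp [derivativeMatrix, Function.iterate_succ_apply']
  · simp

theorem strictMono_append_val_succ (k : ℕ) :
    StrictMono (Fin.append (fun i : Fin k => (i : ℕ)) ![k + 1]) := by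
  intro i j hij
  rw [Fin.lt_def] at hij
  induction i using Fin.addCases <;> induction j using Fin.addCases <;>
    simp only [Fin.append_left, Fin.append_right, Fin.val_castAdd, Fin.val_natAdd,
      Matrix.cons_val_fin_one] at hij ⊢ <;> omega

theorem coeff_zero_det_derivativeMatrix {n : ℕ} {e : Fin n → ℕ} (he : StrictMono e)
    {u : Fin n → R[X]} (hu : ∀ i, ∀ l < e i, (u i).coeff l = 0) :
    (derivativeMatrix e u).det.coeff 0 = ∏ i, ((e i).factorial : R) * (u i).coeff (e i) := by
  rw [← constantCoeff_apply, RingHom.map_det, Matrix.det_of_isLowerTriangular]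
  · simp [derivativeMatrix, coeff_iterate_derivative, Nat.descFactorial_self]
  · intro i j hij
    have hij : i < j := hij
    simp [derivativeMatrix, coeff_iterate_derivative, hu j _ (he hij)]

theorem det_derivativeMatrix_append {k m : ℕ} (e : Fin k → ℕ) (f : Fin m → ℕ)
    (u : Fin k → R[X]) (v : Fin m → R[X]) :
    (derivativeMatrix (Fin.append e f) (Fin.append u v)).det =
      (Matrix.fromBlocks (derivativeMatrix e u) (.of fun i j => derivative^[e i] (v j))
        (.of fun i j => derivative^[f i] (u j)) (derivativeMatrix f v)).det := by
  rw [← Matrix.det_submatrix_equiv_self finSumFinEquiv]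
  congr 1
  ext (i | i) (j | j) : 2 <;> simp [derivativeMatrix]

theorem wronskian'_append {k m : ℕ} (u : Fin k → R[X]) (v : Fin m → R[X]) :
    wronskian' (Fin.append u v) =
      (derivativeMatrix (Fin.append (fun i : Fin k => (i : ℕ)) fun i : Fin m => k + i)
        (Fin.append u v)).det := by
  rw [wronskian'_eq_det]
  congr 2
  ext i
  refine Fin.addCases (fun i => ?_) (fun i => ?_) i <;> simp

theorem wronskian'_append_add_C_mul {k : ℕ} (u : Fin k → R[X]) (b : R) (v w : R[X]) :
    wronskian' (Fin.append u ![C b * v + w]) =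
      C b * wronskian' (Fin.append u ![v]) + wronskian' (Fin.append u ![w]) := by
  have key : ∀ p, derivativeMatrix (fun i : Fin (k + 1) => (i : ℕ)) (Fin.append u ![p]) =
      (derivativeMatrix (fun i : Fin (k + 1) => (i : ℕ)) (Fin.append u ![0])).updateCol
        (Fin.last k) (fun i => derivative^[(i : ℕ)] p) := by
    intro p
    ext i j : 2
    refine Fin.addCases (fun j => ?_) (fun j => ?_) j
    · have h : Fin.castAdd 1 j ≠ Fin.last k := (Fin.castSucc_lt_last j).ne
      rw [Matrix.updateCol_ne h]
      simp [derivativeMatrix]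
    · obtain rfl : j = 0 := Subsingleton.elim _ _
      have h : Fin.natAdd k (0 : Fin 1) = Fin.last k := rfl
      rw [h, Matrix.updateCol_self, ← h]
      simp only [derivativeMatrix, Matrix.of_apply, Fin.append_right]
      simp
  have hcol : (fun i : Fin (k + 1) => derivative^[(i : ℕ)] (C b * v + w)) =
      C b • (fun i : Fin (k + 1) => derivative^[(i : ℕ)] v) +
        fun i : Fin (k + 1) => derivative^[(i : ℕ)] w := by
    ext1 i
    simp [iterate_derivative_C_mul]
  simp only [wronskian'_eq_det]
  rw [key (C b * v + w), key v, key w, hcol, Matrix.det_updateCol_add, Matrix.det_updateCol_smul]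

end DerivativeMatrix

/-- The Desnanot–Jacobi identity for a matrix bordered by two rows and two columns, over a field
and with invertible core. -/
theorem Matrix.det_mul_det_fromBlocks_fin_two_of_field {K n : Type*} [Field K] [Fintype n]
    [DecidableEq n] (A : Matrix n n K) (B : Matrix n (Fin 2) K) (C : Matrix (Fin 2) n K)
    (D : Matrix (Fin 2) (Fin 2) K) (hA : A.det ≠ 0)
    (m : Fin 2 → Fin 2 → K)
    (hm : ∀ i j, m i j = (fromBlocks A (B.submatrix id fun _ : Fin 1 => j)
      (C.submatrix (fun _ : Fin 1 => i) id) (D.submatrix (fun _ => i) fun _ => j)).det) :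
    A.det * (fromBlocks A B C D).det = m 0 0 * m 1 1 - m 0 1 * m 1 0 := by
  let := A.invertibleOfIsUnitDet (isUnit_iff_ne_zero.2 hA)
  have key : ∀ i j, m i j = A.det * (D - C * ⅟A * B) i j := by
    intro i j
    rw [hm, det_fromBlocks₁₁, det_unique (n := Fin 1)]
    rfl
  rw [det_fromBlocks₁₁, det_fin_two, key, key, key, key]
  ring

/-- The Desnanot–Jacobi identity for a matrix bordered by two rows and two columns, over a domain
and with nonsingular core. -/
theorem Matrix.det_mul_det_fromBlocks_fin_two {R n : Type*} [CommRing R] [IsDomain R] [Fintype n]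
    [DecidableEq n] (A : Matrix n n R) (B : Matrix n (Fin 2) R) (C : Matrix (Fin 2) n R)
    (D : Matrix (Fin 2) (Fin 2) R) (hA : A.det ≠ 0)
    (m : Fin 2 → Fin 2 → R)
    (hm : ∀ i j, m i j = (fromBlocks A (B.submatrix id fun _ : Fin 1 => j)
      (C.submatrix (fun _ : Fin 1 => i) id) (D.submatrix (fun _ => i) fun _ => j)).det) :
    A.det * (fromBlocks A B C D).det = m 0 0 * m 1 1 - m 0 1 * m 1 0 := by
  have hinj := IsFractionRing.injective R (FractionRing R)
  let φ := algebraMap R (FractionRing R)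
  apply hinj
  have h := det_mul_det_fromBlocks_fin_two_of_field (A.map φ) (B.map φ) (C.map φ) (D.map φ)
    (by
      rw [← RingHom.mapMatrix_apply, ← RingHom.map_det]
      exact (map_ne_zero_iff φ hinj).2 hA)
    (fun i j => φ (m i j)) (by
      intro i j
      simp only [hm, RingHom.map_det, RingHom.mapMatrix_apply, fromBlocks_map, submatrix_map])
  rw [← fromBlocks_map, ← RingHom.mapMatrix_apply, ← RingHom.mapMatrix_apply, ← RingHom.map_det,
    ← RingHom.map_det] at h
  simpa using h

/-- The classical Wronskian identity
`Wr(u, v) Wr(u, w)' - Wr(u, v)' Wr(u, w) = Wr(u) Wr(u, v, w)`. -/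
theorem wronskian'_append_mul_derivative {R : Type*} [CommRing R] [IsDomain R] {k : ℕ}
    (u : Fin k → R[X]) (v w : R[X]) (hu : wronskian' u ≠ 0) :
    wronskian' (Fin.append u ![v]) * derivative (wronskian' (Fin.append u ![w])) -
        derivative (wronskian' (Fin.append u ![v])) * wronskian' (Fin.append u ![w]) =
      wronskian' u * wronskian' (Fin.append u ![v, w]) := by
  have h := Matrix.det_mul_det_fromBlocks_fin_two
    (derivativeMatrix (fun i : Fin k => (i : ℕ)) u)
    (.of fun i j => derivative^[(i : ℕ)] (![v, w] j))
    (.of fun i j => derivative^[k + (i : ℕ)] (u j))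
    (derivativeMatrix (fun i : Fin 2 => k + (i : ℕ)) ![v, w]) hu
    (fun i j => (derivativeMatrix (Fin.append (fun l : Fin k => (l : ℕ)) ![k + (i : ℕ)])
      (Fin.append u ![![v, w] j])).det)
    (by
      intro i j
      rw [det_derivativeMatrix_append]
      congr 2
      all_goals
        ext a b : 2
        simp [derivativeMatrix])
  have h1 : ∀ p : R[X], wronskian' (Fin.append u ![p]) =
      (derivativeMatrix (Fin.append (fun l : Fin k => (l : ℕ)) ![k]) (Fin.append u ![p])).det := by
    intro p
    rw [wronskian'_append]
    congr 3
    ext i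
    simp
  rw [derivative_wronskian'_succ, derivative_wronskian'_succ, wronskian'_append u ![v, w],
    det_derivativeMatrix_append _ _ u ![v, w], h1, h1]
  rw [← wronskian'_eq_det] at h
  refine Eq.trans ?_ h.symm
  simp
  ring

/-- The Wronskian map intertwines the evolution `A_i(a)` on normalized collections with the
corresponding evolution on tuples of Wronskians.  Here `u : Fin (r+1) → K[X]` is a normalized
collection with nonzero parameters `c` (0-based indexing: `u j` has vanishing coefficients
below degree `j` and coefficient `c j / j!` in degree `j`), `F j = Wr(u_0, …, u_{j-1})`,
and the index `i` of the statement is `k + 1` with `1 ≤ k + 1 ≤ r`. -/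
theorem wronskian_intertwines_evolution {K : Type*} [Field K] [CharZero K]
    (r : ℕ) (hr : 1 ≤ r) (u : Fin (r + 1) → K[X]) (c : Fin (r + 1) → K)
    (hc : ∀ j, c j ≠ 0)
    (hlow : ∀ (j : Fin (r + 1)) (l : ℕ), l < (j : ℕ) → (u j).coeff l = 0)
    (hlead : ∀ j : Fin (r + 1), (u j).coeff (j : ℕ) = c j / (Nat.factorial (j : ℕ) : K))
    (k : ℕ) (hk : k + 1 ≤ r) (a : K) (ha : a ≠ 0) :
    let F : (j : ℕ) → j ≤ r + 1 → K[X] := fun j hj =>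
      wronskian' fun t : Fin j => u (Fin.castLE hj t)
    let g : K[X] :=
      (wronskian' fun t : Fin (k + 1) =>
        if (t : ℕ) < k then u (Fin.castLE (by omega) t)
        else C a⁻¹ * u ⟨k, by omega⟩ + u ⟨k + 1, by omega⟩) -
      C a⁻¹ * F (k + 1) (by omega)
    F (k + 1) (by omega) * derivative g - derivative (F (k + 1) (by omega)) * g =
        F k (by omega) * F (k + 2) (by omega) ∧
      g.coeff 0 = 0 ∧
      g.coeff 1 = (∏ j : Fin k, c (Fin.castLE (by omega) j)) * c ⟨k + 1, by omega⟩ := by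
  intro F g
  set U : Fin k → K[X] := fun t => u (Fin.castLE (by omega) t) with hU
  set v : K[X] := u ⟨k, by omega⟩ with hv
  set w : K[X] := u ⟨k + 1, by omega⟩ with hw
  have hfac : ∀ j : Fin (r + 1), ((j : ℕ).factorial : K) * (u j).coeff (j : ℕ) = c j := by
    intro j
    rw [hlead, mul_div_cancel₀ _ (Nat.cast_ne_zero.2 (Nat.factorial_ne_zero _))]
  have hF1 : F (k + 1) (by omega) = wronskian' (Fin.append U ![v]) := by
    refine congrArg wronskian' (_root_.funext fun t => ?_)
    refine Fin.addCases (fun t => ?_) (fun t => ?_) t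
    · rw [Fin.append_left]; rfl
    · obtain rfl : t = 0 := Subsingleton.elim _ _
      rw [Fin.append_right]; rfl
  have hF2 : F (k + 2) (by omega) = wronskian' (Fin.append U ![v, w]) := by
    refine congrArg wronskian' (_root_.funext fun t => ?_)
    refine Fin.addCases (fun t => ?_) (fun t => ?_) t
    · rw [Fin.append_left]; rfl
    · rw [Fin.append_right]
      fin_cases t <;> rfl
  have hg : g = wronskian' (Fin.append U ![w]) := by
    have : (fun t : Fin (k + 1) => if (t : ℕ) < k then u (Fin.castLE (by omega) t)
        else C a⁻¹ * v + w) = Fin.append U ![C a⁻¹ * v + w] := by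
      funext t
      refine Fin.addCases (fun t => ?_) (fun t => ?_) t
      · rw [Fin.append_left, if_pos (by simp)]; rfl
      · rw [Fin.append_right, if_neg (by simp)]; simp
    simp only [g]
    rw [this, hF1, wronskian'_append_add_C_mul, add_sub_cancel_left]
  have hF0 : wronskian' U ≠ 0 := by
    intro h
    have h0 := coeff_zero_det_derivativeMatrix (e := fun i : Fin k => (i : ℕ))
      Fin.val_strictMono (u := U) fun i l hl => hlow _ l hl
    rw [← wronskian'_eq_det, h, coeff_zero] at h0
    refine Finset.prod_ne_zero_iff.2 (fun i _ => ?_) h0.symm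
    exact (hfac (Fin.castLE (by omega) i)).trans_ne (hc _)
  refine ⟨?_, ?_, ?_⟩
  · rw [hg, hF1, hF2]
    exact wronskian'_append_mul_derivative U v w hF0
  · rw [hg, wronskian'_eq_det, coeff_zero_det_derivativeMatrix, Fin.prod_univ_castSucc]
    · refine mul_eq_zero_of_right _ (mul_eq_zero_of_right _ ?_)
      have h : Fin.last k = Fin.natAdd k (0 : Fin 1) := rfl
      rw [h, Fin.append_right]
      exact hlow ⟨k + 1, by omega⟩ _ (Nat.lt_succ_self k)
    · exact Fin.val_strictMono
    · refine Fin.addCases (fun i => ?_) (fun i => ?_)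
      · rw [Fin.append_left]
        exact fun l hl => hlow (Fin.castLE (by omega) i) l hl
      · obtain rfl : i = 0 := Subsingleton.elim _ _
        rw [Fin.append_right]
        exact fun l hl => hlow ⟨k + 1, by omega⟩ l (Nat.lt_succ_of_lt hl)
  · have hd : g.coeff 1 = (derivative g).coeff 0 := by simp [coeff_derivative]
    rw [hd, hg, derivative_wronskian'_succ, coeff_zero_det_derivativeMatrix, Fin.prod_univ_add]
    · simp only [Fin.append_left, Fin.append_right, Fin.prod_univ_one]
      congr 1
      · exact Finset.prod_congr rfl fun i _ => hfac (Fin.castLE (by omega) i)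
      · exact hfac ⟨k + 1, by omega⟩
    · exact strictMono_append_val_succ k
    · refine Fin.addCases (fun i => ?_) (fun i => ?_)
      · rw [Fin.append_left, Fin.append_left]
        exact fun l hl => hlow (Fin.castLE (by omega) i) l hl
      · obtain rfl : i = 0 := Subsingleton.elim _ _
        rw [Fin.append_right, Fin.append_right]
        exact fun l hl => hlow ⟨k + 1, by omega⟩ l hl
end

section
/- Let K be a field, n ≥ 2, N = n(n−1)/2, and let (i₁, …, i_N) with 1 ≤ i_m ≤ n−1 be such that the product of adjacent transpositions s_{i₁}·⋯·s_{i_N} equals the reversal permutation w₀ : j ↦ n+1−j of {1,…,n}. Let a₁,…,a_N ∈ K and b₁,…,b_N, c₁,…,c_N ∈ K all b_m, c_m nonzero, and for 1 ≤ k ≤ N let M_k = A(a₁,b₁,c₁)_{i₁}·⋯·A(a_k,b_k,c_k)_{i_k}, where A(a,b,c)_i is the n×n matrix equal to the identity except for the 2×2 block [[a, b], [c, 0]] in rows and columns i, i+1. Then: (a) there exists exactly one permutation w of {1,…,n} such that P_w·M_k is c-upper triangular with all antidiagonal entries nonzero, where P_w is the permutation matrix of w; (b) there exists exactly one permutation w′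 of {1,…,n} such that M_k·P_{w′} is c-upper triangular with all antidiagonal entries nonzero. -/
open Matrix

/-- The adjacent transposition `s_m` of `{1,…,n}` (1-based `m`): it swaps the 0-based
indices `m-1` and `m` of `Fin n`, for `1 ≤ m < n` (and is the identity otherwise). -/
def adjSwap (n m : ℕ) : Equiv.Perm (Fin n) :=
  if h : m < n then Equiv.swap ⟨m - 1, lt_of_le_of_lt (Nat.sub_le m 1) h⟩ ⟨m, h⟩ else 1

/-- The `n × n` matrix equal to the identity except for the `2 × 2` block `[[a,b],[c,0]]`
in rows and columns `p, p+1` (0-based `p`). -/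
def blockA {K : Type*} [Field K] (n p : ℕ) (a b c : K) : Matrix (Fin n) (Fin n) K :=
  Matrix.of fun j k =>
    if (j : ℕ) = p ∧ (k : ℕ) = p then a
    else if (j : ℕ) = p ∧ (k : ℕ) = p + 1 then b
    else if (j : ℕ) = p + 1 ∧ (k : ℕ) = p then c
    else if (j : ℕ) = p + 1 ∧ (k : ℕ) = p + 1 then 0
    else if j = k then 1 else 0

/-- The permutation matrix `P_w` of a permutation `w` of `{1,…,n}`. -/
def permMat (K : Type*) [Field K] {n : ℕ} (w : Equiv.Perm (Fin n)) :
    Matrix (Fin n) (Fin n) K :=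
  Matrix.of fun j k => if w k = j then 1 else 0

/-- `M` is c-upper triangular with all antidiagonal entries nonzero:
`M j k = 0` whenever `j + k > n + 1` (1-based) and `M j (n+1-j) ≠ 0` for all `j`. -/
def IsCUpperNZ {K : Type*} [Field K] {n : ℕ} (M : Matrix (Fin n) (Fin n) K) : Prop :=
  (∀ j k : Fin n, n < (j : ℕ) + (k : ℕ) + 1 → M j k = 0) ∧ ∀ j : Fin n, M j j.rev ≠ 0

theorem Equiv.Perm.eq_one_of_forall_le_apply {n : ℕ} (τ : Equiv.Perm (Fin n))
    (h : ∀ x, x ≤ τ x) : τ = 1 := by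
  have hle : ∀ x ∈ (Finset.univ : Finset (Fin n)), (x : ℕ) ≤ (τ x : ℕ) :=
    fun x _ => h x
  have hsum := (Finset.sum_eq_sum_iff_of_le hle).1
    (Equiv.sum_comp τ fun x : Fin n => (x : ℕ)).symm
  ext x
  simpa using (hsum x (Finset.mem_univ x)).symm

theorem Equiv.Perm.eq_revPerm_of_forall_le_rev {n : ℕ} (σ : Equiv.Perm (Fin n))
    (h : ∀ x, σ x ≤ x.rev) : σ = Fin.revPerm := by
  have hone : Fin.revPerm * σ = 1 := Equiv.Perm.eq_one_of_forall_le_apply _ fun x => by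
    simpa using Fin.le_rev_iff.2 (h x)
  ext x
  have hx := DFunLike.congr_fun hone x
  simp only [Equiv.Perm.coe_mul, Function.comp_apply, Fin.revPerm_apply,
    Equiv.Perm.coe_one, id_eq] at hx
  rw [Fin.revPerm_apply, ← Fin.rev_eq_iff.1 hx]

/-- The set of inversions of a permutation of `Fin n`. -/
def inversions {n : ℕ} (v : Equiv.Perm (Fin n)) : Finset (Fin n × Fin n) :=
  Finset.univ.filter fun x => x.1 < x.2 ∧ v x.2 < v x.1

theorem mem_inversions {n : ℕ} {v : Equiv.Perm (Fin n)} {x : Fin n × Fin n} :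
    x ∈ inversions v ↔ x.1 < x.2 ∧ v x.2 < v x.1 := by
  simp [inversions]

theorem swap_lt_swap {n : ℕ} {p q x y : Fin n} (hpq : (q : ℕ) = p + 1) (hxy : x < y)
    (hne : (x, y) ≠ (p, q)) : Equiv.swap p q x < Equiv.swap p q y := by
  simp only [Ne, Prod.mk.injEq, Fin.ext_iff, Fin.lt_def] at *
  simp only [Equiv.swap_apply_def, Fin.ext_iff]
  split_ifs <;> omega

theorem card_inversions_mul_swap_le {n : ℕ} (v : Equiv.Perm (Fin n)) {p q : Fin n}
    (hpq : (q : ℕ) = p + 1) :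
    ((inversions (v * Equiv.swap p q)).erase (p, q)).card ≤ (inversions v).card := by
  refine Finset.card_le_card_of_injOn (Prod.map (Equiv.swap p q) (Equiv.swap p q)) ?_
    ((Equiv.injective _).prodMap (Equiv.injective _)).injOn
  rintro ⟨x, y⟩ hxy
  obtain ⟨hne, hmem⟩ := Finset.mem_erase.1 (Finset.mem_coe.1 hxy)
  obtain ⟨hlt, hv⟩ := mem_inversions.1 hmem
  exact Finset.mem_coe.2 (mem_inversions.2 ⟨swap_lt_swap hpq hlt hne, hv⟩)

theorem card_inversions_mul_swap_le_succ {n : ℕ} (v : Equiv.Perm (Fin n)) {p q : Fin n}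
    (hpq : (q : ℕ) = p + 1) :
    (inversions (v * Equiv.swap p q)).card ≤ (inversions v).card + 1 :=
  tsub_le_iff_right.1 (Finset.pred_card_le_card_erase.trans (card_inversions_mul_swap_le v hpq))

theorem card_inversions_mul_swap_le_of_lt {n : ℕ} (v : Equiv.Perm (Fin n)) {p q : Fin n}
    (hpq : (q : ℕ) = p + 1) (hv : v q < v p) :
    (inversions (v * Equiv.swap p q)).card ≤ (inversions v).card := by
  refine le_of_eq_of_le ?_ (card_inversions_mul_swap_le v hpq)
  rw [Finset.erase_eq_of_notMem]
  simpa [mem_inversions] using fun _ => hv.le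

theorem card_inversions_one (n : ℕ) : (inversions (1 : Equiv.Perm (Fin n))).card = 0 := by
  rw [Finset.card_eq_zero, Finset.eq_empty_iff_forall_notMem]
  intro x hx
  obtain ⟨h, h'⟩ := mem_inversions.1 hx
  exact lt_asymm h h'

theorem card_inversions_revPerm (n : ℕ) :
    (inversions (Fin.revPerm : Equiv.Perm (Fin n))).card = n * (n - 1) / 2 := by
  have hcard : (inversions (Fin.revPerm : Equiv.Perm (Fin n))).card =
      ∑ y : Fin n, (y : ℕ) := by
    rw [Finset.card_eq_sum_card_fiberwise (f := Prod.snd) (t := Finset.univ)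
      fun _ _ => Finset.mem_coe.2 (Finset.mem_univ _)]
    refine Finset.sum_congr rfl fun y _ => ?_
    rw [← Fin.card_Iio y]
    refine Finset.card_nbij' Prod.fst (fun x => (x, y)) ?_ ?_ ?_ ?_
    · rintro ⟨x, z⟩ h
      simp only [Finset.coe_filter, Set.mem_ofPred_eq, mem_inversions] at h
      simpa [← h.2] using h.1.1
    · intro x h
      simpa [mem_inversions] using h
    · rintro ⟨x, z⟩ h
      simp only [Finset.coe_filter, Set.mem_ofPred_eq] at h
      simp [← h.2]
    · intro x _
      rfl
  rw [hcard, Fin.sum_univ_eq_sum_range (fun y => y), Finset.sum_range_id]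

/-- `M` lies in both `P_v · L` and `U · P_v`, where `L` and `U` are the invertible lower and
upper triangular matrices. -/
structure IsTriangularAlong {K : Type*} [Field K] {n : ℕ} (v : Equiv.Perm (Fin n))
    (M : Matrix (Fin n) (Fin n) K) : Prop where
  le_apply : ∀ j k, M j k ≠ 0 → j ≤ v k
  le_symm_apply : ∀ j k, M (v j) k ≠ 0 → k ≤ j
  apply_ne_zero : ∀ k, M (v k) k ≠ 0

theorem isTriangularAlong_one {K : Type*} [Field K] {n : ℕ} :
    IsTriangularAlong (1 : Equiv.Perm (Fin n)) (1 : Matrix (Fin n) (Fin n) K) where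
  le_apply j k h := by
    by_contra hne
    exact h (Matrix.one_apply_ne fun hjk => hne hjk.le)
  le_symm_apply j k h := by
    by_contra hne
    exact h (Matrix.one_apply_ne fun hjk => hne (by simpa using hjk.ge))
  apply_ne_zero k := by
    rw [Equiv.Perm.one_apply, Matrix.one_apply_eq]
    exact one_ne_zero

theorem mul_blockA_apply {K : Type*} [Field K] {n : ℕ} (M : Matrix (Fin n) (Fin n) K)
    {p q : Fin n} (hpq : (q : ℕ) = p + 1) (a b c : K) (j k : Fin n) :
    (M * blockA n p a b c) j k =
      if k = p then M j p * a + M j q * c else if k = q then M j p * b else M j k := by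
  have hqp : p ≠ q := fun h => by simp [h] at hpq
  rw [Matrix.mul_apply]
  split_ifs with h1 h2
  · subst h1
    rw [Finset.sum_eq_add k q hqp]
    · simp [blockA, hpq]
    · rintro x - ⟨hxp, hxq⟩
      rw [Ne, Fin.ext_iff] at hxp hxq
      simp [blockA, hxp, ← hpq, hxq, Fin.ext_iff]
    · simp
    · simp
  · subst h2
    rw [Finset.sum_eq_single p]
    · simp [blockA, hpq]
    · rintro x - hxp
      rw [Ne, Fin.ext_iff] at hxp
      by_cases hxq : x = k
      · simp [blockA, hxq, hpq]
      · simp [blockA, hxp, hxq, hpq]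
    · simp
  · rw [Finset.sum_eq_single k]
    · simp [blockA, ← hpq, ← Fin.ext_iff, h1, h2]
    · rintro x - hx
      simp [blockA, ← hpq, ← Fin.ext_iff, h1, h2, hx]
    · simp

theorem IsTriangularAlong.mul_blockA {K : Type*} [Field K] {n : ℕ}
    {v : Equiv.Perm (Fin n)} {M : Matrix (Fin n) (Fin n) K} (hM : IsTriangularAlong v M)
    {p q : Fin n} (hpq : (q : ℕ) = p + 1) (hv : v p < v q) {a b c : K}
    (hb : b ≠ 0) (hc : c ≠ 0) :
    IsTriangularAlong (v * Equiv.swap p q) (M * blockA n p a b c) := by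
  have hqp : q ≠ p := fun h => by simp [h] at hpq
  have hzero : M (v q) p = 0 := by
    by_contra h
    exact absurd (hM.le_apply _ _ h) (not_le.2 hv)
  refine ⟨fun j k h => ?_, fun j k h => ?_, fun k => ?_⟩
  · rw [mul_blockA_apply M hpq] at h
    rw [Equiv.Perm.mul_apply]
    split_ifs at h with h1 h2
    · rw [h1, Equiv.swap_apply_left]
      by_cases hp : M j p = 0
      · exact hM.le_apply _ _ fun hq => h (by simp [hp, hq])
      · exact (hM.le_apply _ _ hp).trans hv.le
    · rw [h2, Equiv.swap_apply_right]
      exact hM.le_apply _ _ (left_ne_zero_of_mul h)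
    · rw [Equiv.swap_apply_of_ne_of_ne h1 h2]
      exact hM.le_apply _ _ h
  · rw [mul_blockA_apply M hpq, Equiv.Perm.mul_apply] at h
    have key : ∀ {x}, M (v (Equiv.swap p q j)) x ≠ 0 → x ≤ Equiv.swap p q j :=
      fun hx => hM.le_symm_apply _ _ hx
    have hjq : M (v (Equiv.swap p q j)) p ≠ 0 → j ≠ p := by
      rintro hx rfl
      rw [Equiv.swap_apply_left] at hx
      exact hx hzero
    split_ifs at h with h1 h2
    · have hle : p ≤ Equiv.swap p q j := by
        by_cases hp : M (v (Equiv.swap p q j)) p = 0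
        · refine le_trans ?_ (key (x := q) fun hq => h (by simp [hp, hq]))
          rw [Fin.le_def]; omega
        · exact key hp
      rw [Equiv.swap_apply_def] at hle
      split_ifs at hle <;> simp only [Fin.le_def, Fin.ext_iff] at * <;> omega
    · have hp := left_ne_zero_of_mul h
      have hle := key hp
      have hj := hjq hp
      rw [Equiv.swap_apply_def] at hle
      split_ifs at hle <;> simp only [Fin.le_def, Fin.ext_iff, Ne] at * <;> omega
    · have hle := key h
      rw [Equiv.swap_apply_def] at hle
      split_ifs at hle <;> simp only [Fin.le_def, Fin.ext_iff] at * <;> omega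
  · rw [mul_blockA_apply M hpq, Equiv.Perm.mul_apply]
    split_ifs with h1 h2
    · rw [h1, Equiv.swap_apply_left, hzero, zero_mul, zero_add]
      exact mul_ne_zero (hM.apply_ne_zero q) hc
    · rw [h2, Equiv.swap_apply_right]
      exact mul_ne_zero (hM.apply_ne_zero p) hb
    · rw [Equiv.swap_apply_of_ne_of_ne h1 h2]
      exact hM.apply_ne_zero k

theorem permMat_mul_apply {K : Type*} [Field K] {n : ℕ} (w : Equiv.Perm (Fin n))
    (M : Matrix (Fin n) (Fin n) K) (j k : Fin n) :
    (permMat K w * M) (w j) k = M j k := by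
  simp [Matrix.mul_apply, permMat]

theorem mul_permMat_apply {K : Type*} [Field K] {n : ℕ} (w : Equiv.Perm (Fin n))
    (M : Matrix (Fin n) (Fin n) K) (j k : Fin n) :
    (M * permMat K w) j k = M j (w k) := by
  simp [Matrix.mul_apply, permMat]

theorem isCUpperNZ_iff {K : Type*} [Field K] {n : ℕ} {M : Matrix (Fin n) (Fin n) K} :
    IsCUpperNZ M ↔ (∀ j k, M j k ≠ 0 → j ≤ k.rev) ∧ ∀ j, M j j.rev ≠ 0 := by
  refine and_congr_left' (forall₂_congr fun j k => ?_)
  rw [← not_imp_not, Fin.le_def, Fin.val_rev]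
  refine imp_congr_right fun _ => ?_
  omega

theorem IsTriangularAlong.existsUnique_permMat_mul {K : Type*} [Field K] {n : ℕ}
    {v : Equiv.Perm (Fin n)} {M : Matrix (Fin n) (Fin n) K} (hM : IsTriangularAlong v M) :
    ∃! w : Equiv.Perm (Fin n), IsCUpperNZ (permMat K w * M) := by
  have hrow : ∀ j k : Fin n,
      (permMat K (Fin.revPerm * v⁻¹ : Equiv.Perm (Fin n)) * M) j k = M (v j.rev) k := by
    intro j k
    have hj : (Fin.revPerm * v⁻¹ : Equiv.Perm (Fin n)) (v j.rev) = j :=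
      (Fin.rev_eq_iff.1 (v.symm_apply_apply j.rev).symm).symm
    rw [← permMat_mul_apply (Fin.revPerm * v⁻¹) M (v j.rev) k, hj]
  refine ⟨Fin.revPerm * v⁻¹, isCUpperNZ_iff.2 ⟨fun j k h => ?_, fun j => ?_⟩, fun w hw => ?_⟩
  · rw [hrow] at h
    exact Fin.le_rev_iff.1 (hM.le_symm_apply _ _ h)
  · rw [hrow]
    exact hM.apply_ne_zero _
  · rw [eq_mul_inv_iff_mul_eq]
    refine Equiv.Perm.eq_revPerm_of_forall_le_rev _ fun k => ?_
    refine (isCUpperNZ_iff.1 hw).1 _ _ ?_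
    rw [Equiv.Perm.mul_apply, permMat_mul_apply]
    exact hM.apply_ne_zero k

theorem IsTriangularAlong.existsUnique_mul_permMat {K : Type*} [Field K] {n : ℕ}
    {v : Equiv.Perm (Fin n)} {M : Matrix (Fin n) (Fin n) K} (hM : IsTriangularAlong v M) :
    ∃! w : Equiv.Perm (Fin n), IsCUpperNZ (M * permMat K w) := by
  refine ⟨v⁻¹ * Fin.revPerm, isCUpperNZ_iff.2 ⟨fun j k h => ?_, fun j => ?_⟩, fun w hw => ?_⟩
  · rw [mul_permMat_apply] at h
    simpa using hM.le_apply _ _ h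
  · rw [mul_permMat_apply]
    simpa using hM.apply_ne_zero (v⁻¹ j)
  · rw [eq_inv_mul_iff_mul_eq]
    refine Equiv.Perm.eq_revPerm_of_forall_le_rev _ fun k => ?_
    refine (isCUpperNZ_iff.1 hw).1 _ _ ?_
    rw [mul_permMat_apply]
    exact hM.apply_ne_zero (w k)

theorem adjSwap_eq_swap {n m : ℕ} {p q : Fin n} (hpq : (q : ℕ) = p + 1) (hq : m = q) :
    adjSwap n m = Equiv.swap p q := by
  subst hq
  rw [adjSwap, dif_pos q.isLt]
  congr 1
  ext
  simp [hpq]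

theorem List.prod_take_ofFn_succ {α : Type*} [Monoid α] {N : ℕ} (f : Fin N → α) {k : ℕ}
    (hk : k < N) :
    ((List.ofFn f).take (k + 1)).prod = ((List.ofFn f).take k).prod * f ⟨k, hk⟩ := by
  rw [List.prod_take_succ _ _ (by simpa using hk), List.getElem_ofFn]

/-- Truncated products along a reduced decomposition of the longest element of `S(n)`:
for each `1 ≤ k ≤ N` there is exactly one permutation `w` with `P_w · M_k` c-upper
triangular with nonzero antidiagonal, and exactly one permutation `w′` with
`M_k · P_{w′}` c-upper triangular with nonzero antidiagonal. -/
theorem truncated_product_unique_permutation {K : Type*} [Field K]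
    (n N : ℕ) (hn : 2 ≤ n) (hN : N = n * (n - 1) / 2)
    (i : Fin N → ℕ) (hi : ∀ m, 1 ≤ i m ∧ i m ≤ n - 1)
    (hred : (List.ofFn fun m => adjSwap n (i m)).prod = Fin.revPerm)
    (a b c : Fin N → K) (hb : ∀ m, b m ≠ 0) (hc : ∀ m, c m ≠ 0)
    (k : ℕ) (hk1 : 1 ≤ k) (hkN : k ≤ N) :
    (∃! w : Equiv.Perm (Fin n),
        IsCUpperNZ (permMat K w *
          ((List.ofFn fun m => blockA n (i m - 1) (a m) (b m) (c m)).take k).prod)) ∧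
    (∃! w' : Equiv.Perm (Fin n),
        IsCUpperNZ
          (((List.ofFn fun m => blockA n (i m - 1) (a m) (b m) (c m)).take k).prod *
            permMat K w')) := by
  set v : ℕ → Equiv.Perm (Fin n) :=
    fun k => ((List.ofFn fun m => adjSwap n (i m)).take k).prod with hv
  have hstep : ∀ m : Fin N, ∃ p q : Fin n, (q : ℕ) = p + 1 ∧ i m - 1 = p ∧
      v (m + 1) = v m * Equiv.swap p q := by
    intro m
    obtain ⟨h1, h2⟩ := hi m
    have hpq : ((⟨i m, by omega⟩ : Fin n) : ℕ) = (⟨i m - 1, by omega⟩ : Fin n) + 1 := by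
      simp only; omega
    refine ⟨_, _, hpq, rfl, ?_⟩
    rw [hv, ← adjSwap_eq_swap hpq rfl]
    exact List.prod_take_ofFn_succ _ m.isLt
  have hgrow : ∀ l k : ℕ, k + l ≤ N →
      (inversions (v (k + l))).card ≤ (inversions (v k)).card + l := by
    intro l
    induction l with
    | zero => simp
    | succ l ih =>
      intro k hkl
      obtain ⟨p, q, hpq, -, hs⟩ := hstep ⟨k + l, hkl⟩
      have := card_inversions_mul_swap_le_succ (v (k + l)) hpq
      rw [← hs] at this
      have := ih k (by omega)
      simp only [← add_assoc] at *
      omega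
  have hzero : (inversions (v 0)).card = 0 := card_inversions_one n
  have hfull : (inversions (v N)).card = N := by
    have hvN : v N = Fin.revPerm := by
      rw [← hred, hv]
      simp only
      rw [List.take_of_length_le (by simp)]
    rw [hvN, card_inversions_revPerm, hN]
  have hascent : ∀ (m : Fin N) (p q : Fin n), (q : ℕ) = p + 1 →
      v (m + 1) = v m * Equiv.swap p q → v m p < v m q := by
    intro m p q hpq hs
    by_contra hlt
    have hne : v m q ≠ v m p := fun h => by simp [(v m).injective h] at hpq
    have h1 := card_inversions_mul_swap_le_of_lt (v m) hpq
      (lt_of_le_of_ne (not_lt.1 hlt) hne)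
    rw [← hs] at h1
    have h2 := hgrow m 0 (by omega)
    have h3 := hgrow (N - (m + 1)) (m + 1) (by omega)
    rw [Nat.add_sub_cancel' m.isLt] at h3
    rw [zero_add] at h2
    omega
  have main : ∀ k ≤ N, IsTriangularAlong (v k)
      ((List.ofFn fun m => blockA n (i m - 1) (a m) (b m) (c m)).take k).prod := by
    intro k
    induction k with
    | zero => exact fun _ => isTriangularAlong_one
    | succ k ih =>
      intro hk
      obtain ⟨p, q, hpq, hp, hs⟩ := hstep ⟨k, hk⟩
      have hlt := hascent ⟨k, hk⟩ p q hpq hs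
      simp only at hs hlt
      rw [List.prod_take_ofFn_succ _ hk, hs, hp]
      exact (ih (by omega)).mul_blockA hpq hlt (hb _) (hc _)
  exact ⟨(main k hkN).existsUnique_permMat_mul, (main k hkN).existsUnique_mul_permMat⟩
end
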